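/- arXiv:0804.0947 — 2 statements merged into one kernel-verified Lean document; each statement's English description precedes it below -/
import Mathlib

section
/- Choose for each conjugacy class c of W a representative w_c ∈ c. Then the images of the elements w_c in the quotient k[W]/(k[W])‾, as c ranges over the conjugacy classes of W such that ε(z) = 1 for every z in the centraliser C_W(w_c), form a k-basis of k[W]/(k[W])‾. -/
/-- Conjugation by the group element `s`, as a `k`-linear endomorphism of the group algebra
`k[W]`: it sends `f` to `s * f * s⁻¹`. -/
noncomputable def adConj (k : Type*) [Field k] {W : Type*} [Group W] (s : W) :
    MonoidAlgebra k W →ₗ[k] MonoidAlgebra k W :=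
  (LinearMap.mulRight k (MonoidAlgebra.of k W s⁻¹)).comp
    (LinearMap.mulLeft k (MonoidAlgebra.of k W s))

open MonoidAlgebra in
theorem adConj_of (k : Type*) [Field k] {W : Type*} [Group W] (s g : W) :
    adConj k s (of k W g) = of k W (s * g * s⁻¹) := by
  simp only [adConj, LinearMap.comp_apply, LinearMap.mulLeft_apply, LinearMap.mulRight_apply,
    map_mul]

/-- The `ε`-twisted class function on `W` supported on the conjugacy class of `x`: it sends
`w * x * w⁻¹` to `ε w`, provided that `ε` is trivial on the centraliser of `x`. -/
noncomputable def twistedClassFun {W k : Type*} [Group W] [Field k] (ε : W →* kˣ) (x g : W) : k :=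
  open Classical in if h : ∃ w, w * x * w⁻¹ = g then (ε h.choose : k) else 0

section twistedClassFun

variable {W k : Type*} [Group W] [Field k] {ε : W →* kˣ} {x : W}

theorem twistedClassFun_conj_self (hx : ∀ z ∈ Subgroup.centralizer {x}, ε z = 1) (w : W) :
    twistedClassFun ε x (w * x * w⁻¹) = ε w := by
  have h : ∃ v, v * x * v⁻¹ = w * x * w⁻¹ := ⟨w, rfl⟩
  rw [twistedClassFun, dif_pos h]
  have hv := h.choose_spec
  set v := h.choose
  have hz : w⁻¹ * v ∈ Subgroup.centralizer {x} := by
    rw [Subgroup.mem_centralizer_singleton_iff]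
    have hvx : v * x = w * x * w⁻¹ * v := by rw [← hv]; group
    rw [mul_assoc, hvx]
    group
  have h1 := hx _ hz
  rw [map_mul, map_inv, inv_mul_eq_one] at h1
  rw [h1]

theorem twistedClassFun_of_not_isConj {g : W} (hg : ¬ IsConj x g) :
    twistedClassFun ε x g = 0 :=
  dif_neg fun h => hg (isConj_iff.mpr h)

theorem twistedClassFun_conj (hx : ∀ z ∈ Subgroup.centralizer {x}, ε z = 1) (s g : W) :
    twistedClassFun ε x (s * g * s⁻¹) = ε s * twistedClassFun ε x g := by
  by_cases hg : IsConj x g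
  · obtain ⟨w, rfl⟩ := isConj_iff.mp hg
    have h : s * (w * x * w⁻¹) * s⁻¹ = s * w * x * (s * w)⁻¹ := by group
    rw [h, twistedClassFun_conj_self hx, twistedClassFun_conj_self hx, map_mul, Units.val_mul]
  · have hsg : IsConj g (s * g * s⁻¹) := isConj_iff.mpr ⟨s, rfl⟩
    rw [twistedClassFun_of_not_isConj hg,
      twistedClassFun_of_not_isConj fun h => hg (h.trans hsg.symm), mul_zero]

/-- The linear functional on the group algebra extending `twistedClassFun`. -/
noncomputable def twistedClassFunctional (ε : W →* kˣ) (x : W) : MonoidAlgebra k W →ₗ[k] k :=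
  (MonoidAlgebra.basis W k).constr k (twistedClassFun ε x)

theorem twistedClassFunctional_of (g : W) :
    twistedClassFunctional ε x (MonoidAlgebra.of k W g) = twistedClassFun ε x g := by
  rw [MonoidAlgebra.of_apply, ← MonoidAlgebra.basis_apply, twistedClassFunctional,
    Module.Basis.constr_basis]

theorem twistedClassFunctional_adConj (hx : ∀ z ∈ Subgroup.centralizer {x}, ε z = 1) (s : W)
    (f : MonoidAlgebra k W) :
    twistedClassFunctional ε x (adConj k s f) = ε s * twistedClassFunctional ε x f := by
  suffices h : twistedClassFunctional ε x ∘ₗ adConj k s =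
      (ε s : k) • twistedClassFunctional ε x from LinearMap.congr_fun h f
  refine (MonoidAlgebra.basis W k).ext fun g => ?_
  rw [MonoidAlgebra.basis_apply, ← MonoidAlgebra.of_apply, LinearMap.comp_apply, adConj_of,
    LinearMap.smul_apply, twistedClassFunctional_of, twistedClassFunctional_of,
    twistedClassFun_conj hx, smul_eq_mul]

theorem iSup_eqLocus_adConj_le_ker [CharZero k] {B : Type*} {s : B → W}
    (hs : ∀ i, ε (s i) = -1) (hx : ∀ z ∈ Subgroup.centralizer {x}, ε z = 1) :
    ⨆ i, LinearMap.eqLocus (adConj k (s i)) LinearMap.id ≤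
      LinearMap.ker (twistedClassFunctional ε x) := by
  refine iSup_le fun i f hf => ?_
  have h := twistedClassFunctional_adConj hx (s i) f
  rw [show adConj k (s i) f = f from hf, hs, Units.val_neg, Units.val_one, neg_one_mul] at h
  exact CharZero.eq_neg_self_iff.mp h

end twistedClassFun

theorem mkQ_of_conj_eq_smul {B W : Type*} [Group W] {M : CoxeterMatrix B}
    (cs : CoxeterSystem M W) {k : Type*} [Field k]
    {ε : W →* kˣ} (hε : ∀ i : B, ε (cs.simple i) = -1) {N : Submodule k (MonoidAlgebra k W)}
    (hN : ∀ i, LinearMap.eqLocus (adConj k (cs.simple i)) LinearMap.id ≤ N) (w g : W) :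
    N.mkQ (MonoidAlgebra.of k W (w * g * w⁻¹)) = (ε w : k) • N.mkQ (MonoidAlgebra.of k W g) := by
  induction w using cs.simple_induction_left with
  | one => simp
  | mul_simple_left w i ih =>
    have h : cs.simple i * w * g * (cs.simple i * w)⁻¹ =
        cs.simple i * (w * g * w⁻¹) * (cs.simple i)⁻¹ := by group
    rw [h, map_mul ε, hε, neg_one_mul, Units.val_neg, neg_smul, ← ih, eq_neg_iff_add_eq_zero,
      ← map_add, Submodule.mkQ_apply, Submodule.Quotient.mk_eq_zero]
    refine hN i ?_
    rw [LinearMap.mem_eqLocus, map_add, adConj_of, adConj_of, LinearMap.id_apply, add_comm]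
    simp [mul_assoc]

/-- Choose for each conjugacy class `c` of `W` a representative `w_c ∈ c`.  Then
the images of the elements `w_c` in the quotient `k[W]/(k[W])‾`, as `c` ranges over the
conjugacy classes of `W` such that `ε(z) = 1` for every `z` in the centraliser `C_W(w_c)`,
form a `k`-basis of `k[W]/(k[W])‾`.  Here `(k[W])‾ = ∑_{s ∈ S} k[W]^{Ad(s)}` with respect to
the conjugation action. -/
theorem dynkin_stmt3 {B W : Type*} [Group W] {M : CoxeterMatrix B}
    (cs : CoxeterSystem M W) {k : Type*} [Field k] [CharZero k]
    (ε : W →* kˣ) (hε : ∀ i : B, ε (cs.simple i) = -1)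
    (kWbar : Submodule k (MonoidAlgebra k W))
    (hbar : kWbar = ⨆ i : B, LinearMap.eqLocus (adConj k (cs.simple i)) LinearMap.id)
    (rep : ConjClasses W → W) (hrep : ∀ c, ConjClasses.mk (rep c) = c) :
    LinearIndependent k
      (fun c : {c : ConjClasses W // ∀ z ∈ Subgroup.centralizer {rep c}, ε z = 1} =>
        (Submodule.Quotient.mk (MonoidAlgebra.of k W (rep c.1)) :
          MonoidAlgebra k W ⧸ kWbar)) ∧
    Submodule.span k
      (Set.range
        (fun c : {c : ConjClasses W // ∀ z ∈ Subgroup.centralizer {rep c}, ε z = 1} =>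
          (Submodule.Quotient.mk (MonoidAlgebra.of k W (rep c.1)) :
            MonoidAlgebra k W ⧸ kWbar))) = ⊤ := by
  constructor
  · refine LinearIndependent.of_pairwise_dual_eq_zero_one _
      (fun c => kWbar.liftQ (twistedClassFunctional ε (rep c.1))
        (hbar ▸ iSup_eqLocus_adConj_le_ker hε c.2)) (fun c d hcd => ?_) fun c => ?_
    · beta_reduce
      rw [Submodule.liftQ_apply, twistedClassFunctional_of]
      refine twistedClassFun_of_not_isConj fun h => hcd (Subtype.ext ?_)
      rw [← hrep c, ← hrep d, ConjClasses.mk_eq_mk_iff_isConj]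
      exact h
    · rw [Submodule.liftQ_apply, twistedClassFunctional_of]
      simpa using twistedClassFun_conj_self c.2 1
  · have hconj := mkQ_of_conj_eq_smul cs hε (N := kWbar) fun i => hbar ▸ le_iSup
      (fun i => LinearMap.eqLocus (adConj k (cs.simple i)) LinearMap.id) i
    rw [eq_top_iff, ← Submodule.range_mkQ kWbar, LinearMap.range_eq_map,
      ← (MonoidAlgebra.basis W k).span_eq, Submodule.map_span_le]
    rintro _ ⟨g, rfl⟩
    rw [MonoidAlgebra.basis_apply, ← MonoidAlgebra.of_apply]
    obtain ⟨w, hw⟩ := isConj_iff.mp (ConjClasses.mk_eq_mk_iff_isConj.mp (hrep (ConjClasses.mk g)))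
    rw [← hw, hconj]
    refine Submodule.smul_mem _ _ ?_
    by_cases hc : ∀ z ∈ Subgroup.centralizer {rep (ConjClasses.mk g)}, ε z = 1
    · exact Submodule.subset_span ⟨⟨_, hc⟩, rfl⟩
    · push Not at hc
      obtain ⟨z, hz, hz1⟩ := hc
      have h := hconj z (rep (ConjClasses.mk g))
      rw [Subgroup.mem_centralizer_singleton_iff.mp hz, mul_inv_cancel_right] at h
      have h0 :
          (1 - (ε z : k)) • kWbar.mkQ (MonoidAlgebra.of k W (rep (ConjClasses.mk g))) = 0 := by
        rw [sub_smul, one_smul, ← h, sub_self]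
      rcases smul_eq_zero.mp h0 with h1 | h1
      · exact absurd (Units.ext (sub_eq_zero.mp h1).symm) hz1
      · rw [h1]
        exact Submodule.zero_mem _
end

section
/- Let n ≥ 1 and let W = S_{n+1} be the symmetric group on n+1 letters (Equiv.Perm (Fin (n+1))). Then the sign-isotypic subspace {f ∈ k[W] : σ f σ⁻¹ = sign(σ) f for all σ ∈ W} of the group algebra k[W] under the conjugation action has k-dimension equal to the number of partitions of n+1 all of whose parts are odd and pairwise distinct. -/
/-- The sign-isotypic subspace `{f ∈ k[W] : w f w⁻¹ = ε(w) f for all w ∈ W}` of the group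
algebra `k[W]` for the conjugation action, where `ε : W → k` is a character. -/
noncomputable def signIsotypic (k : Type*) [Field k] (W : Type*) [Group W] (ε : W → k) :
    Submodule k (MonoidAlgebra k W) :=
  ⨅ w : W, LinearMap.eqLocus (adConj k w) (ε w • LinearMap.id)

open Equiv.Perm in
/-- Every partition is the partition of some permutation. -/
theorem Equiv.Perm.partition_surjective {α : Type*} [Fintype α] [DecidableEq α] :
    Function.Surjective (Equiv.Perm.partition (α := α)) := by
  intro p
  have hsplit : p.parts.filter (2 ≤ ·) + p.parts.filter (¬ 2 ≤ ·) = p.parts :=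
    Multiset.filter_add_not _ _
  have hones : p.parts.filter (¬ 2 ≤ ·) =
      Multiset.replicate (p.parts.filter (¬ 2 ≤ ·)).card 1 := by
    rw [Multiset.eq_replicate_card]
    intro b hb
    have hb' := Multiset.mem_filter.mp hb
    have := p.parts_pos hb'.1
    omega
  have hsum : (p.parts.filter (2 ≤ ·)).sum + (p.parts.filter (¬ 2 ≤ ·)).card =
      Fintype.card α := by
    have h := congrArg Multiset.sum hsplit
    rw [Multiset.sum_add, p.parts_sum, hones, Multiset.sum_replicate] at h
    simpa using h
  obtain ⟨σ, hσ⟩ := (exists_with_cycleType_iff α (m := p.parts.filter (2 ≤ ·))).mpr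
    ⟨by omega, fun a ha => (Multiset.mem_filter.mp ha).2⟩
  refine ⟨σ, Nat.Partition.ext ?_⟩
  rw [parts_partition, ← sum_cycleType, hσ, Nat.sub_eq_of_eq_add' hsum.symm, ← hones, hsplit]

open Equiv.Perm in
/-- The centralizer of a permutation consists of even permutations if and only if its cycle
lengths, fixed points included, are odd and pairwise distinct. -/
theorem Equiv.Perm.centralizer_le_ker_sign_iff {α : Type*} [Fintype α] [DecidableEq α]
    (g : Equiv.Perm α) :
    Subgroup.centralizer {g} ≤ (Equiv.Perm.sign (α := α)).ker ↔
      (∀ i ∈ g.partition.parts, Odd i) ∧ g.partition.parts.Nodup := by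
  have hdisj (m : ℕ) : _root_.Disjoint g.cycleType (Multiset.replicate m 1) := by
    rw [Multiset.disjoint_right]
    intro a ha h
    have h2 := two_le_of_mem_cycleType h
    rw [Multiset.eq_of_mem_replicate ha] at h2
    omega
  have hodd (m : ℕ) : ∀ i ∈ Multiset.replicate m 1, Odd i := fun i hi => by
    rw [Multiset.eq_of_mem_replicate hi]
    exact odd_one
  have hrep : (Multiset.replicate (Fintype.card α - g.support.card) 1).Nodup ↔
      Fintype.card α ≤ g.cycleType.sum + 1 := by
    rw [Multiset.nodup_iff_count_le_one, sum_cycleType]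
    constructor
    · intro h
      have := h 1
      rw [Multiset.count_replicate_self] at this
      omega
    · intro h a
      rw [Multiset.count_replicate]
      split_ifs <;> omega
  rw [show (Equiv.Perm.sign (α := α)).ker = alternatingGroup α from rfl,
    centralizer_le_alternating_iff, parts_partition, Multiset.nodup_add, hrep,
    ← Multiset.nodup_iff_count_le_one]
  simp only [Multiset.mem_add, or_imp, forall_and]
  exact ⟨fun ⟨h1, h2, h3⟩ => ⟨⟨h1, hodd _⟩, h3, h2, hdisj _⟩,
    fun ⟨⟨h1, _⟩, h3, h2, _⟩ => ⟨h1, h2, h3⟩⟩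

/-- Membership in the isotypic subspace, in terms of coefficients. -/
theorem mem_signIsotypic_iff {k : Type*} [Field k] {W : Type*} [Group W] {ε : W → k}
    {f : MonoidAlgebra k W} :
    f ∈ signIsotypic k W ε ↔ ∀ w g, f.coeff (w⁻¹ * g * w) = ε w * f.coeff g := by
  simp only [signIsotypic, Submodule.mem_iInf, LinearMap.mem_eqLocus, adConj,
    MonoidAlgebra.ext_iff, Finsupp.ext_iff]
  simp [MonoidAlgebra.of_apply, mul_assoc]

/-- If `r` represents exactly once each conjugacy class whose stabilizers lie in the kernel of the
sign character `ε`, then the `ε`-isotypic part of the adjoint representation has dimension the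
number of these classes. -/
theorem finrank_signIsotypic {k : Type*} [Field k] [CharZero k] {W : Type*} [Group W] [Finite W]
    (ε : W →* ℤˣ) {ι : Type*} [Finite ι] (r : ι → W)
    (hinj : ∀ i j, IsConj (r i) (r j) → i = j)
    (hker : ∀ i, Subgroup.centralizer {r i} ≤ ε.ker)
    (hcov : ∀ g, Subgroup.centralizer {g} ≤ ε.ker → ∃ i, IsConj (r i) g) :
    Module.finrank k (signIsotypic k W (fun w => ((ε w : ℤ) : k))) = Nat.card ι := by
  classical
  have := Fintype.ofFinite ι
  let E : signIsotypic k W (fun w => ((ε w : ℤ) : k)) →ₗ[k] (ι → k) :=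
    { toFun := fun f i => f.1.coeff (r i)
      map_add' := fun f g => by ext; simp
      map_smul' := fun c f => by ext; simp }
  have hE : Function.Bijective E := by
    constructor
    · rw [injective_iff_map_eq_zero]
      rintro ⟨f, hf⟩ hf0
      rw [mem_signIsotypic_iff] at hf
      have h0 (i : ι) : f.coeff (r i) = 0 := congrFun hf0 i
      refine Subtype.ext (MonoidAlgebra.ext (Finsupp.ext fun g => ?_))
      change f.coeff g = 0
      by_cases hg : Subgroup.centralizer {g} ≤ ε.ker
      · obtain ⟨i, hi⟩ := hcov g hg
        obtain ⟨c, rfl⟩ := isConj_iff.mp hi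
        have := hf c⁻¹ (r i)
        rwa [h0, mul_zero, inv_inv] at this
      · obtain ⟨w, hw, hwε⟩ := SetLike.not_le_iff_exists.mp hg
        have hε : ε w = -1 := (Int.units_eq_one_or (ε w)).resolve_left hwε
        have hwg : w⁻¹ * g * w = g := by
          rw [mul_assoc, Subgroup.mem_centralizer_singleton_iff.mp hw |>.symm, inv_mul_cancel_left]
        have := hf w g
        rw [hwg, hε] at this
        simpa [self_eq_neg] using this
    · intro v
      have hwell {i j : ι} {a b : W} (h : a * r i * a⁻¹ = b * r j * b⁻¹) :
          i = j ∧ ε a = ε b := by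
        have hij : i = j := hinj i j <|
          (isConj_iff.mpr ⟨a, h⟩).trans (isConj_iff.mpr ⟨b, rfl⟩).symm
        subst hij
        refine ⟨rfl, ?_⟩
        have hmem : b⁻¹ * a ∈ Subgroup.centralizer {r i} := by
          rw [Subgroup.mem_centralizer_singleton_iff]
          calc b⁻¹ * a * r i = b⁻¹ * (a * r i * a⁻¹) * a := by group
            _ = r i * (b⁻¹ * a) := by rw [h]; group
        have := MonoidHom.mem_ker.mp (hker i hmem)
        rw [map_mul, map_inv, inv_mul_eq_one] at this
        exact this.symm
      let F : W → k := fun g =>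
        if h : ∃ p : ι × W, p.2 * r p.1 * p.2⁻¹ = g then
          ((ε h.choose.2 : ℤ) : k) * v h.choose.1 else 0
      have hF (i : ι) (a : W) : F (a * r i * a⁻¹) = ((ε a : ℤ) : k) * v i := by
        have h : ∃ p : ι × W, p.2 * r p.1 * p.2⁻¹ = a * r i * a⁻¹ := ⟨(i, a), rfl⟩
        obtain ⟨h1, h2⟩ := hwell h.choose_spec
        simp only [F, dif_pos h]
        rw [h1, h2]
      have hF0 (g : W) (h : ¬ ∃ p : ι × W, p.2 * r p.1 * p.2⁻¹ = g) : F g = 0 := dif_neg h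
      refine ⟨⟨MonoidAlgebra.ofCoeff (Finsupp.equivFunOnFinite.symm F), ?_⟩, ?_⟩
      · rw [mem_signIsotypic_iff]
        intro w g
        change F (w⁻¹ * g * w) = _ * F g
        by_cases h : ∃ p : ι × W, p.2 * r p.1 * p.2⁻¹ = g
        · obtain ⟨⟨i, a⟩, rfl⟩ := h
          have : w⁻¹ * (a * r i * a⁻¹) * w = (w⁻¹ * a) * r i * (w⁻¹ * a)⁻¹ := by group
          rw [this, hF, hF, map_mul, map_inv, Int.units_inv_eq_self]
          push_cast
          ring
        · rw [hF0 g h, hF0, mul_zero]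
          rintro ⟨⟨i, a⟩, hia⟩
          refine h ⟨(i, w * a), ?_⟩
          calc w * a * r i * (w * a)⁻¹ = w * (a * r i * a⁻¹) * w⁻¹ := by group
            _ = g := by rw [hia]; group
      · ext i
        change F (r i) = v i
        simpa using hF i 1
  rw [(LinearEquiv.ofBijective E hE).finrank_eq, Module.finrank_fintype_fun_eq_card,
    Nat.card_eq_fintype_card]

/-- The sign-isotypic part of the adjoint representation of a symmetric group has dimension the
number of partitions into distinct odd parts. -/
theorem finrank_signIsotypic_perm {k : Type*} [Field k] [CharZero k] (α : Type*) [Fintype α]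
    [DecidableEq α] {m : ℕ} (hm : Fintype.card α = m) :
    Module.finrank k
      (signIsotypic k (Equiv.Perm α) (fun σ => ((Equiv.Perm.sign σ : ℤ) : k))) =
      Nat.card {p : Nat.Partition m // (∀ i ∈ p.parts, Odd i) ∧ p.parts.Nodup} := by
  subst hm
  choose r hr using Equiv.Perm.partition_surjective (α := α)
  refine finrank_signIsotypic Equiv.Perm.sign (fun p => r p.1) ?_ ?_ ?_
  · intro p q h
    rw [Equiv.Perm.partition_eq_of_isConj, hr, hr] at h
    exact Subtype.ext h
  · intro p
    rw [Equiv.Perm.centralizer_le_ker_sign_iff, hr]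
    exact p.2
  · intro g hg
    exact ⟨⟨g.partition, g.centralizer_le_ker_sign_iff.mp hg⟩,
      Equiv.Perm.partition_eq_of_isConj.mpr (hr _)⟩


/-- Let `n ≥ 1` and let `W = S_{n+1}` be the symmetric group on `n+1` letters.
Then the sign-isotypic subspace `{f ∈ k[W] : σ f σ⁻¹ = sign(σ) f for all σ ∈ W}` of the group
algebra `k[W]` under the conjugation action has `k`-dimension equal to the number of
partitions of `n+1` all of whose parts are odd and pairwise distinct. -/
theorem dynkin_stmt8 (n : ℕ) (hn : 1 ≤ n) {k : Type*} [Field k] [CharZero k] :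
    Module.finrank k
      (signIsotypic k (Equiv.Perm (Fin (n + 1)))
        (fun σ => ((Equiv.Perm.sign σ : ℤ) : k))) =
      Nat.card {p : Nat.Partition (n + 1) // (∀ i ∈ p.parts, Odd i) ∧ p.parts.Nodup} :=
    finrank_signIsotypic_perm _ (Fintype.card_fin _)
end
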